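/- Geometric structure of the vorticity of an axisymmetric flow: let v be an axisymmetric divergence-free vector field without swirl on ℝ³ and ω = curl v its vorticity. Then (i) ω ∧ e_θ = 0; in particular ω₃ = 0 and ω₁(x₁,0,z) = ω₂(0,x₂,z) = 0 for every (x₁,x₂,z) ∈ ℝ³; (ii) for every q ≥ −1 the Littlewood–Paley block Δ_q v is an axisymmetric vector field and Δ_q ω ∧ e_θ = 0. -/

import Mathlib

open MeasureTheory Real Filter Function Set
open scoped ENNReal Topology FourierTransform

noncomputable section

/-- The ambient space `ℝ³`. -/
abbrev V3 : Type := EuclideanSpace ℝ (Fin 3)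

/-- Standard basis vectors of `ℝ³`. -/
def e3 (i : Fin 3) : V3 := EuclideanSpace.single i 1

/-- Partial derivative `∂ᵢ uⱼ` of a vector field. -/
def pdV (u : V3 → V3) (x : V3) (i j : Fin 3) : ℝ := (fderiv ℝ u x (e3 i)) j

/-- Euclidean dot product on `ℝ³`. -/
def dotV (a b : V3) : ℝ := ∑ i, a i * b i

/-- Divergence of a vector field. -/
def divV (u : V3 → V3) (x : V3) : ℝ := ∑ i, pdV u x i i

/-- Curl of a vector field. -/
def curlV (u : V3 → V3) (x : V3) : V3 :=
  (pdV u x 1 2 - pdV u x 2 1) • e3 0 + (pdV u x 2 0 - pdV u x 0 2) • e3 1 +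
    (pdV u x 0 1 - pdV u x 1 0) • e3 2

/-- Cross product on `ℝ³`. -/
def crossV (a b : V3) : V3 :=
  (a 1 * b 2 - a 2 * b 1) • e3 0 + (a 2 * b 0 - a 0 * b 2) • e3 1 +
    (a 0 * b 1 - a 1 * b 0) • e3 2

/-- Advection `(w · ∇) u` of a vector field. -/
def advect (w u : V3 → V3) (x : V3) : V3 := fderiv ℝ u x (w x)

/-- Advection `(w · ∇) f` of a scalar field. -/
def advectS (w : V3 → V3) (f : V3 → ℝ) (x : V3) : ℝ := fderiv ℝ f x (w x)

/-- Laplacian of a vector field. -/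
def lapV (u : V3 → V3) (x : V3) : V3 :=
  ∑ i, fderiv ℝ (fun y => fderiv ℝ u y (e3 i)) x (e3 i)

/-- Gradient of a scalar field. -/
def gradS (f : V3 → ℝ) (x : V3) : V3 := ∑ i, (fderiv ℝ f x (e3 i)) • e3 i

/-- Time derivative of a time dependent vector field. -/
def tderiv (v : ℝ → V3 → V3) (t : ℝ) (x : V3) : V3 := deriv (fun s => v s x) t

/-- Time derivative of a time dependent scalar field. -/
def tderivS (f : ℝ → V3 → ℝ) (t : ℝ) (x : V3) : ℝ := deriv (fun s => f s x) t

/-- Distance to the `z`-axis. -/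
def rad (x : V3) : ℝ := Real.sqrt (x 0 ^ 2 + x 1 ^ 2)

/-- Radial unit vector of the cylindrical frame (junk value `0` on the axis). -/
def er (x : V3) : V3 := (x 0 / rad x) • e3 0 + (x 1 / rad x) • e3 1

/-- Angular unit vector of the cylindrical frame (junk value `0` on the axis). -/
def eθ (x : V3) : V3 := (-(x 1) / rad x) • e3 0 + (x 0 / rad x) • e3 1

/-- Vertical unit vector of the cylindrical frame. -/
def ez : V3 := e3 2

/-- Rotation of angle `α` around the `z`-axis. -/
def rotZ (α : ℝ) (x : V3) : V3 :=
  (Real.cos α * x 0 - Real.sin α * x 1) • e3 0 +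
    (Real.sin α * x 0 + Real.cos α * x 1) • e3 1 + x 2 • e3 2

/-- A vector field is axisymmetric iff it is equivariant under rotations around the `z`-axis,
i.e. its cylindrical components do not depend on the angular variable. -/
def AxisymV (u : V3 → V3) : Prop := ∀ α x, u (rotZ α x) = rotZ α (u x)

/-- A scalar field is axisymmetric iff it is invariant under rotations around the `z`-axis. -/
def AxisymS (f : V3 → ℝ) : Prop := ∀ α x, f (rotZ α x) = f x

/-- A vector field has no swirl: its angular component vanishes. -/
def NoSwirl (u : V3 → V3) : Prop := ∀ x, dotV (u x) (eθ x) = 0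

/-- A vector field is purely angular: its radial and vertical components vanish. -/
def Angular (u : V3 → V3) : Prop := ∀ x, dotV (u x) (er x) = 0 ∧ dotV (u x) ez = 0

/-- Angular (cylindrical) component of a vector field. -/
def compθ (u : V3 → V3) (x : V3) : ℝ := dotV (u x) (eθ x)

/-- Radial (cylindrical) component of a vector field. -/
def compr (u : V3 → V3) (x : V3) : ℝ := dotV (u x) (er x)

/-- Smoothness of a time dependent vector field. -/
def Smooth2V (v : ℝ → V3 → V3) : Prop := ContDiff ℝ (⊤ : ℕ∞) (uncurry v)

/-- Smoothness of a time dependent scalar field. -/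
def Smooth2S (f : ℝ → V3 → ℝ) : Prop := ContDiff ℝ (⊤ : ℕ∞) (uncurry f)

/-- The incompressible MHD system with viscosity `μ` and resistivity `1`:
`∂ₜv + v·∇v − μΔv + ∇p = B·∇B`, `∂ₜB + v·∇B − ΔB = B·∇v`, `div v = div B = 0`. -/
def SolvesMHD (μ : ℝ) (v B : ℝ → V3 → V3) (pr : ℝ → V3 → ℝ) : Prop :=
  ∀ t x, 0 ≤ t →
    (tderiv v t x + advect (v t) (v t) x - μ • lapV (v t) x + gradS (pr t) x
        = advect (B t) (B t) x) ∧
    (tderiv B t x + advect (v t) (B t) x - lapV (B t) x = advect (B t) (v t) x) ∧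
    divV (v t) x = 0 ∧ divV (B t) x = 0

section Lorentz

variable {F : Type*} [NormedAddCommGroup F]

/-- Decreasing rearrangement of a function. -/
def rearr (f : V3 → F) (t : ℝ) : ℝ :=
  sInf {s : ℝ | 0 ≤ s ∧ volume {x : V3 | s < ‖f x‖} ≤ ENNReal.ofReal t}

/-- Lorentz space `L^{p,q}` quasinorm. -/
def lorentzNorm (p q : ℝ≥0∞) (f : V3 → F) : ℝ≥0∞ :=
  if q = ∞ then ⨆ t : Ioi (0 : ℝ), ENNReal.ofReal ((t : ℝ) ^ (1 / p.toReal) * rearr f t)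
  else (∫⁻ t in Ioi (0 : ℝ),
      (ENNReal.ofReal (t ^ (1 / p.toReal) * rearr f t)) ^ q.toReal / ENNReal.ofReal t) ^
      (1 / q.toReal)

end Lorentz

/-- The reference low-frequency cut-off function `χ`, equal to `1` on the ball of radius `1/2`
and vanishing outside the unit ball. -/
def lpChi (ξ : V3) : ℝ := Real.smoothTransition (2 - 2 * ‖ξ‖)

/-- The reference dyadic bump `φ(ξ) = χ(ξ/2) − χ(ξ)`, supported in an annulus. -/
def lpPhi (ξ : V3) : ℝ := lpChi ((2 : ℝ)⁻¹ • ξ) - lpChi ξ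

/-- Littlewood–Paley block `Δ_q` of a complex valued function, `q ≥ -1`. -/
def LPblockC (q : ℤ) (f : V3 → ℂ) : V3 → ℂ :=
  if q = -1 then 𝓕⁻ (fun ξ => (lpChi ξ : ℂ) * 𝓕 f ξ)
  else 𝓕⁻ (fun ξ => (lpPhi ((2 : ℝ) ^ (-q) • ξ) : ℂ) * 𝓕 f ξ)

/-- Littlewood–Paley block of a real scalar field. -/
def LPblockS (q : ℤ) (f : V3 → ℝ) : V3 → ℝ :=
  fun x => (LPblockC q (fun y => (f y : ℂ)) x).re

/-- Littlewood–Paley block of a vector field. -/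
def LPblockV (q : ℤ) (u : V3 → V3) : V3 → V3 :=
  fun x => ∑ j, (LPblockC q (fun y => ((u y j : ℝ) : ℂ)) x).re • e3 j

/-- Inhomogeneous Besov norm `B^s_{p,r}` of a vector field. -/
def besovV (s : ℝ) (p r : ℝ≥0∞) (u : V3 → V3) : ℝ≥0∞ :=
  if r = ∞ then
    ⨆ q : ℕ, ENNReal.ofReal ((2 : ℝ) ^ (((q : ℝ) - 1) * s)) *
      eLpNorm (LPblockV ((q : ℤ) - 1) u) p volume
  else
    (∑' q : ℕ, (ENNReal.ofReal ((2 : ℝ) ^ (((q : ℝ) - 1) * s)) *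
      eLpNorm (LPblockV ((q : ℤ) - 1) u) p volume) ^ r.toReal) ^ (1 / r.toReal)

/-- Inhomogeneous Besov norm `B^s_{p,r}` of a scalar field. -/
def besovS (s : ℝ) (p r : ℝ≥0∞) (f : V3 → ℝ) : ℝ≥0∞ :=
  if r = ∞ then
    ⨆ q : ℕ, ENNReal.ofReal ((2 : ℝ) ^ (((q : ℝ) - 1) * s)) *
      eLpNorm (LPblockS ((q : ℤ) - 1) f) p volume
  else
    (∑' q : ℕ, (ENNReal.ofReal ((2 : ℝ) ^ (((q : ℝ) - 1) * s)) *
      eLpNorm (LPblockS ((q : ℤ) - 1) f) p volume) ^ r.toReal) ^ (1 / r.toReal)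

section SpaceTime

variable {F : Type*} [NormedAddCommGroup F]

/-- `L^∞([0,t]; L^p)` norm. -/
def LinfLp (t : ℝ) (p : ℝ≥0∞) (u : ℝ → V3 → F) : ℝ≥0∞ :=
  ⨆ τ : Icc (0 : ℝ) t, eLpNorm (u τ) p volume

/-- `L¹([0,t]; L^p)` norm. -/
def L1Lp (t : ℝ) (p : ℝ≥0∞) (u : ℝ → V3 → F) : ℝ≥0∞ :=
  ∫⁻ τ in Icc (0 : ℝ) t, eLpNorm (u τ) p volume

/-- `L^∞([0,t]; L^{p,q})` Lorentz norm. -/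
def LinfLorentz (t : ℝ) (p q : ℝ≥0∞) (u : ℝ → V3 → F) : ℝ≥0∞ :=
  ⨆ τ : Icc (0 : ℝ) t, lorentzNorm p q (u τ)

end SpaceTime

/-- `L^∞([0,t]; B^s_{p,r})` norm of a vector field. -/
def LinfBesovV (t : ℝ) (s : ℝ) (p r : ℝ≥0∞) (u : ℝ → V3 → V3) : ℝ≥0∞ :=
  ⨆ τ : Icc (0 : ℝ) t, besovV s p r (u τ)

/-- `L¹([0,t]; B^s_{p,r})` norm of a vector field. -/
def L1BesovV (t : ℝ) (s : ℝ) (p r : ℝ≥0∞) (u : ℝ → V3 → V3) : ℝ≥0∞ :=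
  ∫⁻ τ in Icc (0 : ℝ) t, besovV s p r (u τ)

/-- `L²([0,t]; B^s_{p,r})` norm of a vector field. -/
def L2BesovV (t : ℝ) (s : ℝ) (p r : ℝ≥0∞) (u : ℝ → V3 → V3) : ℝ≥0∞ :=
  (∫⁻ τ in Icc (0 : ℝ) t, (besovV s p r (u τ)) ^ 2) ^ (1 / (2 : ℝ))

/-- `L¹([0,t]; B^s_{p,r})` norm of a scalar field. -/
def L1BesovS (t : ℝ) (s : ℝ) (p r : ℝ≥0∞) (f : ℝ → V3 → ℝ) : ℝ≥0∞ :=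
  ∫⁻ τ in Icc (0 : ℝ) t, besovS s p r (f τ)

/-- Chemin–Lerner norm `‖u‖_{𝐿̃^∞([0,t]; B^s_{p,1})}`. -/
def CLInfBesovV (t : ℝ) (s : ℝ) (p : ℝ≥0∞) (u : ℝ → V3 → V3) : ℝ≥0∞ :=
  ∑' q : ℕ, ENNReal.ofReal ((2 : ℝ) ^ (((q : ℝ) - 1) * s)) *
    ⨆ τ : Icc (0 : ℝ) t, eLpNorm (LPblockV ((q : ℤ) - 1) (u τ)) p volume

/-- Chemin–Lerner norm `‖u‖_{𝐿̃¹([0,t]; B^s_{p,1})}`. -/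
def CL1BesovV (t : ℝ) (s : ℝ) (p : ℝ≥0∞) (u : ℝ → V3 → V3) : ℝ≥0∞ :=
  ∑' q : ℕ, ENNReal.ofReal ((2 : ℝ) ^ (((q : ℝ) - 1) * s)) *
    ∫⁻ τ in Icc (0 : ℝ) t, eLpNorm (LPblockV ((q : ℤ) - 1) (u τ)) p volume

/-- `Φ_k(t) = C₀ exp(…exp(C₀ t^{5/4})…)`, with `k` iterated exponentials. -/
def PhiFun (C₀ : ℝ) (k : ℕ) (t : ℝ) : ℝ := C₀ * Real.exp^[k] (C₀ * t ^ ((5 : ℝ) / 4))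

/-- `V(t) = ∫₀ᵗ ‖∇v(τ)‖_{L^∞} dτ`. -/
def Vfn (v : ℝ → V3 → V3) (t : ℝ) : ℝ :=
  ∫ τ in Icc (0 : ℝ) t, (eLpNorm (fun x => ‖fderiv ℝ (v τ) x‖) ∞ volume).toReal

/-- `Z(t) = ‖v‖_{L¹([0,t]; B¹_{∞,1})}`. -/
def Zfn (v : ℝ → V3 → V3) (t : ℝ) : ℝ := (L1BesovV t 1 ∞ 1 v).toReal

/-- Continuity in time with values in the Besov space `B^s_{p,r}`, on `ℝ₊`. -/
def BesovContV (s : ℝ) (p r : ℝ≥0∞) (u : ℝ → V3 → V3) : Prop :=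
  (∀ t, 0 ≤ t → besovV s p r (u t) ≠ ∞) ∧
  (∀ t, 0 ≤ t → Tendsto (fun τ => besovV s p r (fun x => u τ x - u t x))
    (𝓝[Ici (0 : ℝ)] t) (𝓝 0))

end

noncomputable section

/-- Frobenius norm of the gradient of a vector field. -/
def gradFrob (u : V3 → V3) (x : V3) : ℝ := Real.sqrt (∑ i, ∑ j, (pdV u x i j) ^ 2)

/-- The point of `ℝ³` with cartesian coordinates `(a, b, c)`. -/
def ptV (a b c : ℝ) : V3 := a • e3 0 + b • e3 1 + c • e3 2

/-- Radial derivative `∂_r f` of a scalar field. -/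
def pdr (f : V3 → ℝ) (x : V3) : ℝ := fderiv ℝ f x (er x)

/-- Vertical derivative `∂_z f` of a scalar field. -/
def pdz (f : V3 → ℝ) (x : V3) : ℝ := fderiv ℝ f x ez

/-- Second radial derivative `∂_r² f`. -/
def pdrr (f : V3 → ℝ) (x : V3) : ℝ := fderiv ℝ (fun y => pdr f y) x (er x)

/-- Second vertical derivative `∂_z² f`. -/
def pdzz (f : V3 → ℝ) (x : V3) : ℝ := fderiv ℝ (fun y => pdz f y) x ez

/-- The vorticity-like equation `∂ₜζ + (v·∇)ζ − Δζ = (ζ·∇)v + curl(B·∇B)`. -/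
def SolvesVortLike (v B ζ : ℝ → V3 → V3) : Prop :=
  ∀ t x, 0 ≤ t →
    tderiv ζ t x + advect (v t) (ζ t) x - lapV (ζ t) x
      = advect (ζ t) (v t) x + curlV (fun y => advect (B t) (B t) y) x

end

open MeasureTheory Set

noncomputable section AxisSymmetry

open Real
open scoped FourierTransform

@[simp]
theorem rotZ_apply_zero (α : ℝ) (x : V3) : rotZ α x 0 = cos α * x 0 - sin α * x 1 := by
  simp [rotZ, e3]

@[simp]
theorem rotZ_apply_one (α : ℝ) (x : V3) : rotZ α x 1 = sin α * x 0 + cos α * x 1 := by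
  simp [rotZ, e3]

@[simp]
theorem rotZ_apply_two (α : ℝ) (x : V3) : rotZ α x 2 = x 2 := by
  simp [rotZ, e3]

theorem V3.ext {x y : V3} (h0 : x 0 = y 0) (h1 : x 1 = y 1) (h2 : x 2 = y 2) : x = y := by
  ext i
  fin_cases i <;> assumption

/-- The linear isometry underlying `rotZ`. -/
def rotZIso (α : ℝ) : V3 ≃ₗᵢ[ℝ] V3 :=
  LinearIsometry.toLinearIsometryEquiv
    { toFun := rotZ α
      map_add' := fun x y => by apply V3.ext <;> simp <;> ring
      map_smul' := fun c x => by apply V3.ext <;> simp <;> ring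
      norm_map' := fun x => by
        rw [← sq_eq_sq₀ (norm_nonneg _) (norm_nonneg _)]
        change ‖rotZ α x‖ ^ 2 = ‖x‖ ^ 2
        simp only [EuclideanSpace.real_norm_sq_eq, Fin.sum_univ_three, rotZ_apply_zero,
          rotZ_apply_one, rotZ_apply_two]
        linear_combination (x 0 ^ 2 + x 1 ^ 2) * sin_sq_add_cos_sq α } rfl

@[simp]
theorem rotZIso_apply (α : ℝ) (x : V3) : rotZIso α x = rotZ α x := rfl

/-- Reflection across the plane `x₁ = 0`, as a plain map. -/
def reflY (x : V3) : V3 := x 0 • e3 0 - x 1 • e3 1 + x 2 • e3 2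

@[simp]
theorem reflY_apply_zero (x : V3) : reflY x 0 = x 0 := by simp [reflY, e3]

@[simp]
theorem reflY_apply_one (x : V3) : reflY x 1 = -x 1 := by simp [reflY, e3]

@[simp]
theorem reflY_apply_two (x : V3) : reflY x 2 = x 2 := by simp [reflY, e3]

/-- The linear isometry underlying `reflY`. -/
def reflYIso : V3 ≃ₗᵢ[ℝ] V3 :=
  LinearIsometry.toLinearIsometryEquiv
    { toFun := reflY
      map_add' := fun x y => by apply V3.ext <;> simp; ring
      map_smul' := fun c x => by apply V3.ext <;> simp
      norm_map' := fun x => by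
        rw [← sq_eq_sq₀ (norm_nonneg _) (norm_nonneg _)]
        change ‖reflY x‖ ^ 2 = ‖x‖ ^ 2
        simp [EuclideanSpace.real_norm_sq_eq, Fin.sum_univ_three] } rfl

@[simp]
theorem reflYIso_apply (x : V3) : reflYIso x = reflY x := rfl

@[simp]
theorem ptV_apply_zero (a b c : ℝ) : ptV a b c 0 = a := by simp [ptV, e3]

@[simp]
theorem ptV_apply_one (a b c : ℝ) : ptV a b c 1 = b := by simp [ptV, e3]

@[simp]
theorem ptV_apply_two (a b c : ℝ) : ptV a b c 2 = c := by simp [ptV, e3]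

theorem exists_eq_rotZ_ptV (x : V3) : ∃ α r z, x = rotZ α (ptV r 0 z) := by
  let w : ℂ := ⟨x 0, x 1⟩
  refine ⟨w.arg, ‖w‖, x 2, V3.ext ?_ ?_ ?_⟩
  · rw [rotZ_apply_zero, ptV_apply_zero, ptV_apply_one]
    linear_combination -Complex.norm_mul_cos_arg w
  · rw [rotZ_apply_one, ptV_apply_zero, ptV_apply_one]
    linear_combination -Complex.norm_mul_sin_arg w
  · simp

/-- A field transforming like a pseudovector under the reflection across the plane `x₁ = 0`. -/
def PseudoReflY (u : V3 → V3) : Prop := ∀ x, u (reflY x) = -reflY (u x)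

theorem AxisymV.apply_axis {u : V3 → V3} (hu : AxisymV u) (z : ℝ) :
    u (ptV 0 0 z) 0 = 0 ∧ u (ptV 0 0 z) 1 = 0 := by
  have h := hu π (ptV 0 0 z)
  have hx : rotZ π (ptV 0 0 z) = ptV 0 0 z := by apply V3.ext <;> simp
  rw [hx] at h
  have h0 := congrArg (fun y : V3 => y 0) h
  have h1 := congrArg (fun y : V3 => y 1) h
  simp at h0 h1
  constructor <;> linarith

theorem AxisymV.apply_one_eq_zero {u : V3 → V3} (hu : AxisymV u) (hs : NoSwirl u) (r z : ℝ) :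
    u (ptV r 0 z) 1 = 0 := by
  rcases eq_or_ne r 0 with rfl | hr
  · exact (hu.apply_axis z).2
  · have h := hs (ptV r 0 z)
    have hrad : rad (ptV r 0 z) ≠ 0 := by simp [rad, sqrt_sq_eq_abs, hr]
    simpa [dotV, eθ, e3, Fin.sum_univ_three, hr, hrad] using h

theorem AxisymV.map_reflY {u : V3 → V3} (hu : AxisymV u) (hs : NoSwirl u) (x : V3) :
    u (reflY x) = reflY (u x) := by
  obtain ⟨α, r, z, rfl⟩ := exists_eq_rotZ_ptV x
  have hx : reflY (rotZ α (ptV r 0 z)) = rotZ (-α) (ptV r 0 z) := by apply V3.ext <;> simp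
  have h1 := hu.apply_one_eq_zero hs r z
  rw [hx, hu, hu]
  apply V3.ext <;> simp [h1]

theorem fderiv_equivariant {u : V3 → V3} (hd : Differentiable ℝ u) (L : V3 ≃ₗᵢ[ℝ] V3)
    (hL : ∀ x, u (L x) = L (u x)) (x y : V3) :
    fderiv ℝ u (L x) (L y) = L (fderiv ℝ u x y) := by
  have h1 : HasFDerivAt (fun x => u (L x))
      ((fderiv ℝ u (L x)).comp (L.toContinuousLinearEquiv : V3 →L[ℝ] V3)) x :=
    (hd (L x)).hasFDerivAt.comp x L.toContinuousLinearEquiv.hasFDerivAt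
  have h2 : HasFDerivAt (fun x => L (u x))
      ((L.toContinuousLinearEquiv : V3 →L[ℝ] V3).comp (fderiv ℝ u x)) x :=
    L.toContinuousLinearEquiv.hasFDerivAt.comp x (hd x).hasFDerivAt
  rw [funext hL] at h1
  exact DFunLike.congr_fun (h1.unique h2) y

@[simp]
theorem curlV_apply_zero (u : V3 → V3) (x : V3) : curlV u x 0 = pdV u x 1 2 - pdV u x 2 1 := by
  simp [curlV, e3]

@[simp]
theorem curlV_apply_one (u : V3 → V3) (x : V3) : curlV u x 1 = pdV u x 2 0 - pdV u x 0 2 := by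
  simp [curlV, e3]

@[simp]
theorem curlV_apply_two (u : V3 → V3) (x : V3) : curlV u x 2 = pdV u x 0 1 - pdV u x 1 0 := by
  simp [curlV, e3]

theorem AxisymV.curlV {u : V3 → V3} (hu : AxisymV u) (hd : Differentiable ℝ u) :
    AxisymV (curlV u) := by
  intro α x
  have key (y : V3) := fderiv_equivariant hd (rotZIso α) (hu α) x y
  simp only [rotZIso_apply] at key
  set D := fderiv ℝ u (rotZ α x) with hD
  have h0 : D (e3 0) = cos α • rotZ α (fderiv ℝ u x (e3 0))
      - sin α • rotZ α (fderiv ℝ u x (e3 1)) := by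
    rw [← key, ← key, ← map_smul, ← map_smul, ← map_sub]
    congr 1
    apply V3.ext <;> simp [e3] <;> linarith [sin_sq_add_cos_sq α]
  have h1 : D (e3 1) = sin α • rotZ α (fderiv ℝ u x (e3 0))
      + cos α • rotZ α (fderiv ℝ u x (e3 1)) := by
    rw [← key, ← key, ← map_smul, ← map_smul, ← map_add]
    congr 1
    apply V3.ext <;> simp [e3] <;> linarith [sin_sq_add_cos_sq α]
  have h2 : D (e3 2) = rotZ α (fderiv ℝ u x (e3 2)) := by
    rw [← key]
    congr 1
    apply V3.ext <;> simp [e3]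
  apply V3.ext
  · simp [pdV, ← hD, h1, h2]; ring
  · simp [pdV, ← hD, h0, h2]; ring
  · simp [pdV, ← hD, h0, h1]
    linear_combination (fderiv ℝ u x (e3 0) 1 - fderiv ℝ u x (e3 1) 0) * sin_sq_add_cos_sq α

theorem pseudoReflY_curlV {u : V3 → V3} (hu : ∀ x, u (reflY x) = reflY (u x))
    (hd : Differentiable ℝ u) : PseudoReflY (curlV u) := by
  intro x
  have key (y : V3) := fderiv_equivariant hd reflYIso hu x y
  simp only [reflYIso_apply] at key
  set D := fderiv ℝ u (reflY x) with hD
  have h0 : D (e3 0) = reflY (fderiv ℝ u x (e3 0)) := by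
    rw [← key]; congr 1; apply V3.ext <;> simp [e3]
  have h1 : D (e3 1) = -reflY (fderiv ℝ u x (e3 1)) := by
    rw [← key, ← map_neg]; congr 1; apply V3.ext <;> simp [e3]
  have h2 : D (e3 2) = reflY (fderiv ℝ u x (e3 2)) := by
    rw [← key]; congr 1; apply V3.ext <;> simp [e3]
  apply V3.ext <;> simp [pdV, ← hD, h0, h1, h2] <;> ring

theorem PseudoReflY.apply_ptV_eq_zero {u : V3 → V3} (hr : PseudoReflY u) (r z : ℝ) :
    u (ptV r 0 z) 0 = 0 ∧ u (ptV r 0 z) 2 = 0 := by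
  have h := hr (ptV r 0 z)
  have hx : reflY (ptV r 0 z) = ptV r 0 z := by apply V3.ext <;> simp
  rw [hx] at h
  have h0 := congrArg (fun y : V3 => y 0) h
  have h2 := congrArg (fun y : V3 => y 2) h
  simp at h0 h2
  constructor <;> linarith

theorem AxisymV.apply_two_eq_zero {u : V3 → V3} (hu : AxisymV u) (hr : PseudoReflY u) (x : V3) :
    u x 2 = 0 := by
  obtain ⟨α, r, z, rfl⟩ := exists_eq_rotZ_ptV x
  rw [hu, rotZ_apply_two]
  exact (hr.apply_ptV_eq_zero r z).2

theorem AxisymV.crossV_eθ_eq_zero {u : V3 → V3} (hu : AxisymV u) (hr : PseudoReflY u) (x : V3) :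
    crossV (u x) (eθ x) = 0 := by
  have h2 := hu.apply_two_eq_zero hr x
  have h01 : u x 0 * x 0 + u x 1 * x 1 = 0 := by
    obtain ⟨α, r, z, rfl⟩ := exists_eq_rotZ_ptV x
    rw [hu]
    simp [(hr.apply_ptV_eq_zero r z).1]
    ring
  apply V3.ext
  · simp [crossV, eθ, e3, h2]
  · simp [crossV, eθ, e3, h2]
  · simp [crossV, eθ, e3]
    linear_combination h01 / rad x

/-- The Fourier multiplier defining the Littlewood–Paley block `Δ_q`. -/
def lpMultiplier (q : ℤ) (ξ : V3) : ℂ :=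
  if q = -1 then (lpChi ξ : ℂ) else (lpPhi ((2 : ℝ) ^ (-q) • ξ) : ℂ)

theorem LPblockC_eq (q : ℤ) (f : V3 → ℂ) :
    LPblockC q f = 𝓕⁻ (fun ξ => lpMultiplier q ξ * 𝓕 f ξ) := by
  by_cases hq : q = -1 <;> simp [LPblockC, lpMultiplier, hq]

theorem continuous_lpChi : Continuous lpChi :=
  smoothTransition.continuous.comp (by fun_prop)

theorem hasCompactSupport_lpChi : HasCompactSupport lpChi :=
  HasCompactSupport.intro (isCompact_closedBall (0 : V3) 1) fun x hx => by
    have : 1 < ‖x‖ := by simpa using hx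
    exact smoothTransition.zero_of_nonpos (by linarith)

theorem continuous_lpMultiplier (q : ℤ) : Continuous (lpMultiplier q) := by
  have := continuous_lpChi
  unfold lpMultiplier lpPhi
  split_ifs <;> fun_prop

theorem hasCompactSupport_lpMultiplier (q : ℤ) : HasCompactSupport (lpMultiplier q) := by
  have h1 : HasCompactSupport lpPhi :=
    (hasCompactSupport_lpChi.comp_smul (by norm_num : (2 : ℝ)⁻¹ ≠ 0)).sub hasCompactSupport_lpChi
  have h2 := h1.comp_smul (zpow_ne_zero (-q) (two_ne_zero : (2 : ℝ) ≠ 0))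
  unfold lpMultiplier
  split_ifs
  · exact hasCompactSupport_lpChi.comp_left (g := ((↑) : ℝ → ℂ)) Complex.ofReal_zero
  · exact h2.comp_left (g := ((↑) : ℝ → ℂ)) Complex.ofReal_zero

theorem lpMultiplier_isometry (q : ℤ) (L : V3 ≃ₗᵢ[ℝ] V3) (ξ : V3) :
    lpMultiplier q (L ξ) = lpMultiplier q ξ := by
  simp [lpMultiplier, lpPhi, lpChi, norm_smul]

theorem LPblockC_comp_isometry (q : ℤ) (L : V3 ≃ₗᵢ[ℝ] V3) (f : V3 → ℂ) (x : V3) :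
    LPblockC q (f ∘ L) x = LPblockC q f (L x) := by
  rw [LPblockC_eq, LPblockC_eq, ← fourierInv_comp_linearIsometry]
  refine congrArg (fun h : V3 → ℂ => 𝓕⁻ h x) (funext fun ξ => ?_)
  simp [fourier_comp_linearIsometry, lpMultiplier_isometry]

theorem fourier_const_mul (c : ℂ) (f : V3 → ℂ) (ξ : V3) :
    𝓕 (fun y => c * f y) ξ = c * 𝓕 f ξ := by
  simp only [fourier_eq, ← smul_eq_mul, smul_comm _ c, integral_smul]

theorem fourierInv_const_mul (c : ℂ) (f : V3 → ℂ) (x : V3) :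
    𝓕⁻ (fun y => c * f y) x = c * 𝓕⁻ f x := by
  simp only [fourierInv_eq_fourier_neg, fourier_const_mul]

theorem fourier_add_apply {f g : V3 → ℂ} (hf : Integrable f) (hg : Integrable g) (ξ : V3) :
    𝓕 (fun y => f y + g y) ξ = 𝓕 f ξ + 𝓕 g ξ := by
  simp only [fourier_eq, smul_add]
  exact integral_add ((fourierIntegral_convergent_iff ξ).2 hf)
    ((fourierIntegral_convergent_iff ξ).2 hg)

theorem fourierInv_add_apply {f g : V3 → ℂ} (hf : Integrable f) (hg : Integrable g) (x : V3) :
    𝓕⁻ (fun y => f y + g y) x = 𝓕⁻ f x + 𝓕⁻ g x := by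
  simp only [fourierInv_eq_fourier_neg, fourier_add_apply hf hg]

theorem LPblockC_const_mul (q : ℤ) (c : ℂ) (f : V3 → ℂ) (x : V3) :
    LPblockC q (fun y => c * f y) x = c * LPblockC q f x := by
  simp only [LPblockC_eq, fourier_const_mul, mul_left_comm _ c, fourierInv_const_mul]

theorem integrable_lpMultiplier_mul_fourier (q : ℤ) {f : V3 → ℂ} (hf : Integrable f) :
    Integrable (fun ξ => lpMultiplier q ξ * 𝓕 f ξ) := by
  have hc : Continuous (𝓕 f) :=
    VectorFourier.fourierIntegral_continuous continuous_fourierChar continuous_inner hf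
  exact ((continuous_lpMultiplier q).mul hc).integrable_of_hasCompactSupport
    ((hasCompactSupport_lpMultiplier q).mul_right)

theorem LPblockC_add (q : ℤ) {f g : V3 → ℂ} (hf : Integrable f) (hg : Integrable g) (x : V3) :
    LPblockC q (fun y => f y + g y) x = LPblockC q f x + LPblockC q g x := by
  simp only [LPblockC_eq, fourier_add_apply hf hg, mul_add]
  exact fourierInv_add_apply (integrable_lpMultiplier_mul_fourier q hf)
    (integrable_lpMultiplier_mul_fourier q hg) x

theorem LPblockC_of_not_integrable (q : ℤ) {f : V3 → ℂ} (hf : ¬Integrable f) (x : V3) :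
    LPblockC q f x = 0 := by
  have h (ξ : V3) : 𝓕 f ξ = 0 := by
    rw [fourier_eq]
    exact integral_undef fun h => hf ((fourierIntegral_convergent_iff ξ).1 h)
  simp [LPblockC_eq, h, fourierInv_eq]

theorem LPblockV_apply (q : ℤ) (u : V3 → V3) (x : V3) (j : Fin 3) :
    LPblockV q u x j = (LPblockC q (fun y => ((u y j : ℝ) : ℂ)) x).re := by
  fin_cases j <;> simp [LPblockV, e3, Fin.sum_univ_three]

theorem AxisymV.integrable_one_iff {u : V3 → V3} (hu : AxisymV u) :
    Integrable (fun y => ((u y 1 : ℝ) : ℂ)) ↔ Integrable (fun y => ((u y 0 : ℝ) : ℂ)) := by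
  have h : (fun y => ((u y 1 : ℝ) : ℂ)) ∘ rotZIso (π / 2) = fun y => ((u y 0 : ℝ) : ℂ) := by
    ext y
    simp [hu (π / 2) y]
  rw [← h]
  exact ((rotZIso (π / 2)).measurePreserving.integrable_comp_emb
    (rotZIso (π / 2)).toHomeomorph.measurableEmbedding).symm

theorem LPblockS_linear_combination (q : ℤ) {f g : V3 → ℝ}
    (hf : Integrable (fun y => (f y : ℂ))) (hg : Integrable (fun y => (g y : ℂ)))
    (a b : ℝ) (x : V3) :
    LPblockS q (fun y => a * f y + b * g y) x = a * LPblockS q f x + b * LPblockS q g x := by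
  simp only [LPblockS, ← Complex.re_ofReal_mul, ← Complex.add_re, ← LPblockC_const_mul,
    ← LPblockC_add q (hf.const_mul _) (hg.const_mul _), Complex.ofReal_add, Complex.ofReal_mul]

theorem AxisymV.LPblockV {u : V3 → V3} (hu : AxisymV u) (q : ℤ) : AxisymV (LPblockV q u) := by
  intro α x
  have hc (j : Fin 3) : LPblockC q (fun y => ((u y j : ℝ) : ℂ)) (rotZ α x)
      = LPblockC q (fun y => ((rotZ α (u y) j : ℝ) : ℂ)) x := by
    rw [← rotZIso_apply, ← LPblockC_comp_isometry]
    simp only [Function.comp_def, rotZIso_apply, hu α]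
  by_cases hi : Integrable (fun y => ((u y 0 : ℝ) : ℂ))
  · have hi' := hu.integrable_one_iff.2 hi
    have h0 := LPblockS_linear_combination q hi hi' (cos α) (-sin α) x
    have h1 := LPblockS_linear_combination q hi hi' (sin α) (cos α) x
    apply V3.ext
    · rw [rotZ_apply_zero]
      simp only [LPblockV_apply, hc, rotZ_apply_zero]
      simpa only [LPblockS, neg_mul, ← sub_eq_add_neg] using h0
    · rw [rotZ_apply_one]
      simp only [LPblockV_apply, hc, rotZ_apply_one]
      exact h1
    · rw [rotZ_apply_two]
      simp only [LPblockV_apply, hc, rotZ_apply_two]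
  · have hi' := mt hu.integrable_one_iff.1 hi
    apply V3.ext
    · simp [LPblockV_apply, LPblockC_of_not_integrable q hi, LPblockC_of_not_integrable q hi']
    · simp [LPblockV_apply, LPblockC_of_not_integrable q hi, LPblockC_of_not_integrable q hi']
    · rw [rotZ_apply_two]
      simp only [LPblockV_apply, hc, rotZ_apply_two]

theorem PseudoReflY.LPblockV {u : V3 → V3} (hu : PseudoReflY u) (q : ℤ) :
    PseudoReflY (LPblockV q u) := by
  intro x
  have hc (j : Fin 3) : LPblockC q (fun y => ((u y j : ℝ) : ℂ)) (reflY x)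
      = -LPblockC q (fun y => ((reflY (u y) j : ℝ) : ℂ)) x := by
    rw [← reflYIso_apply, ← LPblockC_comp_isometry, neg_eq_neg_one_mul, ← LPblockC_const_mul]
    simp [Function.comp_def, hu _]
  have hneg := LPblockC_const_mul q (-1) (fun y => ((u y 1 : ℝ) : ℂ)) x
  simp only [neg_one_mul] at hneg
  apply V3.ext <;> simp [LPblockV_apply, hc, hneg]

end AxisSymmetry


/-- geometric structure of the vorticity of an axisymmetric flow
without swirl, and of its Littlewood–Paley blocks. -/
theorem axisymmetric_vorticity_structure
    (v : V3 → V3) (hv : ContDiff ℝ (⊤ : ℕ∞) v)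
    (hvd : ∀ x, divV v x = 0) (hax : AxisymV v) (hsw : NoSwirl v) :
    ((∀ x, crossV (curlV v x) (eθ x) = 0) ∧
      (∀ x, (curlV v x) 2 = 0) ∧
      (∀ a z : ℝ, (curlV v (ptV a 0 z)) 0 = 0 ∧ (curlV v (ptV 0 a z)) 1 = 0)) ∧
    (∀ q : ℤ, -1 ≤ q →
      AxisymV (LPblockV q v) ∧
      ∀ x, crossV (LPblockV q (curlV v) x) (eθ x) = 0) := by
  have hd : Differentiable ℝ v := hv.differentiable (by simp)
  have hω := hax.curlV hd
  have hr := pseudoReflY_curlV (hax.map_reflY hsw) hd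
  refine ⟨⟨hω.crossV_eθ_eq_zero hr, hω.apply_two_eq_zero hr, fun a z => ?_⟩, fun q _ =>
    ⟨hax.LPblockV q, (hω.LPblockV q).crossV_eθ_eq_zero (hr.LPblockV q)⟩⟩
  have h0 := (hr.apply_ptV_eq_zero a z).1
  refine ⟨h0, ?_⟩
  have hx : ptV 0 a z = rotZ (Real.pi / 2) (ptV a 0 z) := by apply V3.ext <;> simp
  rw [hx, hω, rotZ_apply_one, h0]
  simp
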